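/- For any property Σ_P, if the columns of [X;U] are linearly independent and span the minimum subspace L_P, then (X,U) is sufficiently rich for identifying Σ_P and its number of columns equals the dimension of L_P. -/

import Mathlib

open Matrix

abbrev Sys (n m : ℕ) : Type := Matrix (Fin n) (Fin n) ℝ × Matrix (Fin n) (Fin m) ℝ

/-- The consistency set Σ_D(X,U|A,B): all systems producing the same feedback data. -/
def consistSet {n m k : ℕ} (X : Matrix (Fin n) (Fin k) ℝ) (U : Matrix (Fin m) (Fin k) ℝ)
    (A : Matrix (Fin n) (Fin n) ℝ) (B : Matrix (Fin n) (Fin m) ℝ) : Set (Sys n m) :=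
  {s | s.1 * X + s.2 * U = A * X + B * U}

/-- (X,U) is sufficiently rich for identifying the property P. -/
def suffRich {n m k : ℕ} (X : Matrix (Fin n) (Fin k) ℝ) (U : Matrix (Fin m) (Fin k) ℝ)
    (P : Set (Sys n m)) : Prop :=
  ∀ A B, consistSet X U A B ⊆ P ∨ consistSet X U A B ⊆ Pᶜ

/-- Column span of the stacked matrix [X;U]. -/
def colSpan {n m k : ℕ} (X : Matrix (Fin n) (Fin k) ℝ) (U : Matrix (Fin m) (Fin k) ℝ) :
    Submodule ℝ (Fin n ⊕ Fin m → ℝ) :=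
  Submodule.span ℝ (Set.range (Matrix.fromRows X U)ᵀ)

/-- The minimum subspace L_P: intersection of column spans of all sufficiently rich data. -/
def minSubspace {n m : ℕ} (P : Set (Sys n m)) : Submodule ℝ (Fin n ⊕ Fin m → ℝ) :=
  ⨅ (k : ℕ) (X : Matrix (Fin n) (Fin k) ℝ) (U : Matrix (Fin m) (Fin k) ℝ)
    (_ : suffRich X U P), colSpan X U

def sysMap {n m : ℕ} (s : Sys n m) : (Fin n ⊕ Fin m → ℝ) →ₗ[ℝ] (Fin n → ℝ) :=
  Matrix.toLin' (Matrix.fromCols s.1 s.2)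

theorem sysMap_surj {n m : ℕ} (T : (Fin n ⊕ Fin m → ℝ) →ₗ[ℝ] (Fin n → ℝ)) :
    ∃ s : Sys n m, sysMap s = T := by
  refine ⟨((LinearMap.toMatrix' T).toCols₁, (LinearMap.toMatrix' T).toCols₂), ?_⟩
  simp [sysMap]

def richOn {n m : ℕ} (P : Set (Sys n m)) (L : Submodule ℝ (Fin n ⊕ Fin m → ℝ)) : Prop :=
  ∀ s t : Sys n m, (∀ v ∈ L, sysMap s v = sysMap t v) → s ∈ P → t ∈ P

theorem agree_iff {n m k : ℕ} (X : Matrix (Fin n) (Fin k) ℝ) (U : Matrix (Fin m) (Fin k) ℝ)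
    (s t : Sys n m) :
    s.1 * X + s.2 * U = t.1 * X + t.2 * U ↔ ∀ v ∈ colSpan X U, sysMap s v = sysMap t v := by
  rw [← Matrix.fromCols_mul_fromRows, ← Matrix.fromCols_mul_fromRows]
  constructor
  · intro h v hv
    have : colSpan X U ≤ LinearMap.eqLocus (sysMap s) (sysMap t) := by
      refine Submodule.span_le.2 ?_
      rintro _ ⟨j, rfl⟩
      ext i
      exact congrFun (congrFun h i) j
    exact this hv
  · intro h
    ext i j
    exact congrFun (h _ (Submodule.subset_span ⟨j, rfl⟩)) i

theorem suffRich_iff {n m k : ℕ} (P : Set (Sys n m)) (X : Matrix (Fin n) (Fin k) ℝ)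
    (U : Matrix (Fin m) (Fin k) ℝ) : suffRich X U P ↔ richOn P (colSpan X U) := by
  constructor
  · intro h s t hst hs
    have hst' := (agree_iff X U s t).2 hst
    rcases h s.1 s.2 with h | h
    · exact h hst'.symm
    · exact absurd hs (h (rfl : s.1 * X + s.2 * U = _))
  · intro h A B
    by_cases hP : ((A, B) : Sys n m) ∈ P
    · left
      intro s hs
      exact h (A, B) s ((agree_iff X U (A, B) s).1 (Eq.symm hs)) hP
    · right
      intro s hs hsP
      exact hP (h s (A, B) ((agree_iff X U s (A, B)).1 hs) hsP)

theorem richOn_inf {n m : ℕ} {P : Set (Sys n m)} {L M : Submodule ℝ (Fin n ⊕ Fin m → ℝ)}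
    (hL : richOn P L) (hM : richOn P M) : richOn P (L ⊓ M) := by
  intro s t hst hs
  let f : (Fin n ⊕ Fin m → ℝ) →ₗ.[ℝ] (Fin n → ℝ) := ⟨L, (sysMap s).domRestrict L⟩
  let g : (Fin n ⊕ Fin m → ℝ) →ₗ.[ℝ] (Fin n → ℝ) := ⟨M, (sysMap t).domRestrict M⟩
  have hfg : ∀ (x : f.domain) (y : g.domain), (x : Fin n ⊕ Fin m → ℝ) = y → f x = g y := by
    rintro ⟨x, hx⟩ ⟨y, hy⟩ h
    obtain rfl : x = y := h
    exact hst x ⟨hx, hy⟩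
  obtain ⟨T, hT⟩ := LinearMap.exists_extend (f.sup g hfg).toFun
  obtain ⟨r, rfl⟩ := sysMap_surj T
  have key : ∀ z : (f.sup g hfg).domain, sysMap r z = (f.sup g hfg) z :=
    fun z => LinearMap.congr_fun hT z
  refine hM r t ?_ (hL s r ?_ hs)
  · intro v hv
    have h1 := (LinearPMap.right_le_sup f g hfg).1 hv
    rw [key ⟨v, h1⟩]
    exact ((LinearPMap.right_le_sup f g hfg).2 (x := ⟨v, hv⟩) (y := ⟨v, h1⟩) rfl).symm
  · intro v hv
    have h1 := (LinearPMap.left_le_sup f g hfg).1 hv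
    rw [key ⟨v, h1⟩]
    exact (LinearPMap.left_le_sup f g hfg).2 (x := ⟨v, hv⟩) (y := ⟨v, h1⟩) rfl

theorem exists_colSpan {n m : ℕ} (L : Submodule ℝ (Fin n ⊕ Fin m → ℝ)) :
    ∃ (k : ℕ) (X : Matrix (Fin n) (Fin k) ℝ) (U : Matrix (Fin m) (Fin k) ℝ),
      colSpan X U = L := by
  obtain ⟨k, c, hc⟩ := Submodule.fg_iff_exists_fin_generating_family.1
    (IsNoetherian.noetherian L)
  refine ⟨k, fun i j => c j (Sum.inl i), fun i j => c j (Sum.inr i), ?_⟩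
  rw [← hc]
  refine congrArg (fun d => Submodule.span ℝ (Set.range d)) ?_
  funext j i
  rcases i with i | i <;> rfl

theorem richOn_min {n m : ℕ} (P : Set (Sys n m)) : richOn P (minSubspace P) := by
  have htop : richOn P ⊤ := by
    intro s t h hs
    have h1 : sysMap s = sysMap t := LinearMap.ext fun v => h v trivial
    have h2 := Matrix.toLin'.injective h1
    have h3 := Matrix.fromCols_inj h2
    rwa [← Prod.ext h3.1 h3.2]
  obtain ⟨M, hM, hmin⟩ := WellFounded.has_min (wellFounded_lt
    (α := Submodule ℝ (Fin n ⊕ Fin m → ℝ))) {L | richOn P L} ⟨⊤, htop⟩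
  have : minSubspace P = M := by
    apply le_antisymm
    · obtain ⟨k, X, U, h⟩ := exists_colSpan M
      have hr : suffRich X U P := (suffRich_iff P X U).2 (h ▸ hM)
      rw [← h]
      exact iInf_le_of_le k (iInf_le_of_le X (iInf_le_of_le U (iInf_le _ hr)))
    · refine le_iInf fun k => le_iInf fun X => le_iInf fun U => le_iInf fun hr => ?_
      have h1 := richOn_inf hM ((suffRich_iff P X U).1 hr)
      by_contra hle
      exact hmin _ h1 (lt_of_le_of_ne inf_le_left fun h => hle (inf_eq_left.1 h))
  rw [this]
  exact hM

/-- if the columns of [X;U] are linearly independent and span L_P, then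
(X,U) is sufficiently rich and its number of columns equals dim L_P. -/
theorem statement3 {n m k : ℕ} (hn : 1 ≤ n) (hm : 1 ≤ m) (P : Set (Sys n m))
    (X : Matrix (Fin n) (Fin k) ℝ) (U : Matrix (Fin m) (Fin k) ℝ)
    (hind : LinearIndependent ℝ (Matrix.fromRows X U)ᵀ)
    (hspan : colSpan X U = minSubspace P) :
    suffRich X U P ∧ k = Module.finrank ℝ (minSubspace P) := by
  refine ⟨(suffRich_iff P X U).2 (hspan ▸ richOn_min P), ?_⟩
  rw [← hspan, colSpan, finrank_span_eq_card hind, Fintype.card_fin]
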